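/- arXiv:2006.15845 — 6 statements merged into one kernel-verified Lean document; each statement's English description precedes it below -/
import Mathlib

section
/- Assume that Σ_{i=1}^m a_i(x) > 0 for every x ∈ K, and let β ∈ [0,2]; in the case β = 0 assume additionally that y_i > 0 for every i. Then the infimum of ℓ(μ) = D_β(y|Aμ) over μ ∈ M₊(K) is attained: there exists μ* ∈ M₊(K) such that ℓ(μ*) ≤ ℓ(μ) for all μ ∈ M₊(K). -/
open MeasureTheory Real Set

noncomputable def dbeta (β u v : ℝ) : EReal :=
  if β = 0 then
    if u = 0 ∨ v = 0 then ⊤ else ((u / v - Real.log (u / v) - 1 : ℝ) : EReal)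
  else if β = 1 then
    if v = 0 ∧ 0 < u then ⊤ else ((v - u - u * Real.log (v / u) : ℝ) : EReal)
  else if β < 1 then
    if v = 0 ∧ 0 < u then ⊤
    else (((u ^ β + (β - 1) * v ^ β - β * u * v ^ (β - 1)) / (β * (β - 1)) : ℝ) : EReal)
  else (((u ^ β + (β - 1) * v ^ β - β * u * v ^ (β - 1)) / (β * (β - 1)) : ℝ) : EReal)

noncomputable def Dbeta {m : ℕ} (β : ℝ) (y w : Fin m → ℝ) : EReal :=
  ∑ i, dbeta β (y i) (w i)

noncomputable def lamvec {m : ℕ} (β : ℝ) (y w : Fin m → ℝ) : Fin m → ℝ := fun i =>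
  if 0 < w i then (w i) ^ (β - 2) * (w i - y i)
  else if β = 2 then -(y i) else 0

open Filter Topology in
lemma aux_sub_log : Tendsto (fun s : ℝ => s - Real.log s) atTop atTop := by
  have h : Tendsto (fun s : ℝ => s * (1/2) + (1 - Real.log 2)) atTop atTop :=
    tendsto_atTop_add_const_right _ _ (tendsto_id.atTop_mul_const (by norm_num))
  refine tendsto_atTop_mono' _ ?_ h
  filter_upwards [eventually_gt_atTop 0] with s hs
  have := Real.log_le_sub_one_of_pos (show 0 < s / 2 by positivity)
  rw [Real.log_div hs.ne' (by norm_num)] at this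
  linarith

open Filter Topology in
lemma aux_scal (β u : ℝ) (hβ : β ∈ Icc (0:ℝ) 2) (hu : 0 ≤ u) (hu0 : β = 0 → 0 < u) :
    ∃ g : ℝ → ℝ, ContinuousOn g (Ioi 0) ∧ Tendsto g atTop atTop ∧
      (∀ v, 0 < v → dbeta β u v = (g v : EReal)) ∧
      ((dbeta β u 0 = (g 0 : EReal) ∧ ContinuousOn g (Ici 0)) ∨
        (dbeta β u 0 = ⊤ ∧ Tendsto g (𝓝[>] 0) atTop)) := by
  obtain ⟨hb0, hb2⟩ := hβ
  by_cases h0 : β = 0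
  · have hu' := hu0 h0
    refine ⟨fun v => u / v - Real.log (u / v) - 1, ?_, ?_, ?_, Or.inr ⟨?_, ?_⟩⟩
    · intro v hv
      have hv' : (0:ℝ) < v := hv
      have hv0 : v ≠ 0 := hv'.ne'
      have h1 : ContinuousAt (fun v : ℝ => u / v) v := continuousAt_const.div continuousAt_id hv0
      exact ((h1.sub (h1.log (by positivity))).sub continuousAt_const).continuousWithinAt
    · have h1 : Tendsto (fun v : ℝ => Real.log v) atTop atTop := Real.tendsto_log_atTop
      have h2 : Tendsto (fun v : ℝ => Real.log v + (-Real.log u - 1)) atTop atTop :=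
        tendsto_atTop_add_const_right _ _ h1
      refine tendsto_atTop_mono' _ ?_ h2
      filter_upwards [eventually_gt_atTop 0] with v hv
      rw [Real.log_div hu'.ne' hv.ne']
      have : 0 ≤ u / v := by positivity
      linarith
    · intro v hv
      simp [dbeta, h0, hu'.ne', hv.ne']
    · simp [dbeta, h0]
    · have h1 : Tendsto (fun v : ℝ => u / v) (𝓝[>] 0) atTop := by
        simp_rw [div_eq_mul_inv]
        exact tendsto_inv_nhdsGT_zero.const_mul_atTop hu'
      have := tendsto_atTop_add_const_right _ (-1) (aux_sub_log.comp h1)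
      refine this.congr (fun v => ?_)
      simp [sub_eq_add_neg]
  by_cases h1 : β = 1
  · rcases hu.eq_or_lt with rfl | hu'
    · refine ⟨fun v => v, continuousOn_id, tendsto_id, ?_, Or.inl ⟨?_, continuousOn_id⟩⟩
      · intro v hv
        simp [dbeta, h1]
      · simp [dbeta, h1]
    · refine ⟨fun v => v - u - u * Real.log (v / u), ?_, ?_, ?_, Or.inr ⟨?_, ?_⟩⟩
      · intro v hv
        have hv' : (0:ℝ) < v := hv
        have h2 : ContinuousAt (fun v : ℝ => v / u) v := continuousAt_id.div_const u
        exact ((continuousAt_id.sub continuousAt_const).sub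
          (continuousAt_const.mul (h2.log (by positivity)))).continuousWithinAt
      · have h2 : Tendsto (fun v : ℝ => v / u) atTop atTop := tendsto_id.atTop_div_const hu'
        have h3 := (tendsto_atTop_add_const_right _ (-1) (aux_sub_log.comp h2)).const_mul_atTop hu'
        refine h3.congr (fun v => ?_)
        simp only [Function.comp]
        field_simp
        ring
      · intro v hv
        simp [dbeta, h1, hv.ne']
      · simp [dbeta, h1, hu']
      · have h2 : Tendsto (fun v : ℝ => u * (-Real.log v) + (u * Real.log u - u)) (𝓝[>] 0) atTop :=
          tendsto_atTop_add_const_right _ _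
            ((tendsto_neg_atBot_atTop.comp Real.tendsto_log_nhdsGT_zero).const_mul_atTop hu')
        refine tendsto_atTop_mono' _ ?_ h2
        filter_upwards [self_mem_nhdsWithin] with v hv
        have hv' : (0:ℝ) < v := hv
        rw [Real.log_div hv'.ne' hu'.ne']
        nlinarith
  have hbp : 0 < β := lt_of_le_of_ne hb0 (Ne.symm h0)
  have hb1 : β - 1 ≠ 0 := sub_ne_zero.2 h1
  by_cases h2 : β < 1
  · have e1 : 0 < 1 - β := by linarith
    rcases hu.eq_or_lt with rfl | hu'
    · have hc : Continuous (fun v : ℝ => v ^ β / β) :=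
        (Real.continuous_rpow_const hb0).div_const _
      have key : ∀ v, dbeta β 0 v = ((v ^ β / β : ℝ) : EReal) := by
        intro v
        simp only [dbeta, h0, h1, h2, if_true, if_false, lt_irrefl, and_false]
        congr 1
        rw [Real.zero_rpow h0]
        field_simp
        ring
      exact ⟨fun v => v ^ β / β, hc.continuousOn, (tendsto_rpow_atTop hbp).atTop_div_const hbp,
        fun v _ => key v, Or.inl ⟨key 0, hc.continuousOn⟩⟩
    · refine ⟨fun v => v ^ β / β + u / (1 - β) * v ^ (β - 1) + u ^ β / (β * (β - 1)),
        ?_, ?_, ?_, Or.inr ⟨?_, ?_⟩⟩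
      · intro v hv
        have hv' : (0:ℝ) < v := hv
        exact ((((Real.continuousAt_rpow_const _ _ (Or.inl hv'.ne')).div_const _).add
          (continuousAt_const.mul (Real.continuousAt_rpow_const _ _ (Or.inl hv'.ne')))).add
          continuousAt_const).continuousWithinAt
      · have h3 := tendsto_atTop_add_const_right atTop (u ^ β / (β * (β - 1)))
          ((tendsto_rpow_atTop hbp).atTop_div_const hbp)
        refine tendsto_atTop_mono' _ ?_ h3
        filter_upwards [eventually_gt_atTop 0] with v hv
        have : 0 ≤ u / (1 - β) * v ^ (β - 1) := by positivity
        linarith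
      · intro v hv
        simp only [dbeta, h0, h1, h2, if_true, if_false, hv.ne', false_and]
        congr 1
        have : (1 - β) ≠ 0 := e1.ne'
        field_simp
        ring
      · simp [dbeta, h0, h1, h2, hu']
      · have h3 := tendsto_atTop_add_const_right _ (u ^ β / (β * (β - 1)))
          ((tendsto_rpow_neg_nhdsGT_zero (show β - 1 < 0 by linarith)).const_mul_atTop
            (show 0 < u / (1 - β) by positivity))
        refine tendsto_atTop_mono' _ ?_ h3
        filter_upwards [self_mem_nhdsWithin] with v hv
        have hv' : (0:ℝ) < v := hv
        have : 0 ≤ v ^ β / β := by positivity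
        linarith
  · have h3 : 0 < β - 1 := lt_of_le_of_ne (by linarith) (Ne.symm hb1)
    have hc : Continuous (fun v : ℝ =>
        (u ^ β + (β - 1) * v ^ β - β * u * v ^ (β - 1)) / (β * (β - 1))) :=
      ((continuous_const.add (continuous_const.mul (Real.continuous_rpow_const hb0))).sub
        (continuous_const.mul (Real.continuous_rpow_const h3.le))).div_const _
    have key : ∀ v, dbeta β u v = (((u ^ β + (β - 1) * v ^ β - β * u * v ^ (β - 1)) /
        (β * (β - 1)) : ℝ) : EReal) := by
      intro v
      simp only [dbeta, h0, h1, h2, if_false]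
    refine ⟨_, hc.continuousOn, ?_, fun v _ => key v, Or.inl ⟨key 0, hc.continuousOn⟩⟩
    have h4 : Tendsto (fun v : ℝ => v ^ (β - 1) * (v / β + (- (u / (β - 1))))) atTop atTop :=
      (tendsto_rpow_atTop h3).atTop_mul_atTop₀
        (tendsto_atTop_add_const_right _ _ (tendsto_id.atTop_div_const hbp))
    have h5 := tendsto_atTop_add_const_right _ (u ^ β / (β * (β - 1))) h4
    refine h5.congr' ?_
    filter_upwards [eventually_gt_atTop 0] with v hv
    have : v ^ β = v ^ (β - 1) * v := by
      rw [← Real.rpow_add_one hv.ne']; congr 1; ring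
    rw [this]
    field_simp
    ring

open Filter Topology in
lemma aux_lsc (β u : ℝ) (hβ : β ∈ Icc (0:ℝ) 2) (hu : 0 ≤ u) (hu0 : β = 0 → 0 < u) :
    LowerSemicontinuousOn (dbeta β u) (Ici 0) ∧
    (∀ M : ℝ, ∃ R : ℝ, 0 ≤ R ∧ ∀ v, R < v → (M : EReal) < dbeta β u v) ∧
    (∃ B : ℝ, ∀ v, 0 ≤ v → (B : EReal) ≤ dbeta β u v) := by
  obtain ⟨g, hg, ht, hd, h0⟩ := aux_scal β u hβ hu hu0
  have L : LowerSemicontinuousOn (dbeta β u) (Ici 0) := by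
    intro v hv
    rcases (show (0:ℝ) ≤ v from hv).eq_or_lt with rfl | hv'
    · rcases h0 with ⟨h0, hc⟩ | ⟨h0, hc⟩
      · have h1 : ContinuousWithinAt (fun v => (g v : EReal)) (Ici 0) 0 :=
          (continuous_coe_real_ereal.continuousAt).comp_continuousWithinAt (hc 0 hv)
        refine (h1.congr (fun v hv => ?_) h0).lowerSemicontinuousWithinAt
        rcases (show (0:ℝ) ≤ v from hv).eq_or_lt with rfl | hv'
        · exact h0
        · exact hd v hv'
      · intro z hz
        rw [h0] at hz
        obtain ⟨M, hzM, -⟩ := EReal.lt_iff_exists_real_btwn.1 hz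
        have h2 := hc.eventually (eventually_gt_atTop M)
        rw [← Ioi_insert, nhdsWithin_insert, eventually_sup]
        refine ⟨by simpa [h0] using hz, ?_⟩
        filter_upwards [h2, self_mem_nhdsWithin] with v h3 h4
        rw [hd v h4]
        exact hzM.trans (EReal.coe_lt_coe_iff.2 h3)
    · have h1 : ContinuousAt (fun v => (g v : EReal)) v :=
        (continuous_coe_real_ereal.continuousAt).comp (hg.continuousAt (Ioi_mem_nhds hv'))
      have h2 : ContinuousAt (dbeta β u) v := by
        refine h1.congr ?_
        filter_upwards [Ioi_mem_nhds hv'] with w hw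
        exact (hd w hw).symm
      exact h2.lowerSemicontinuousAt.lowerSemicontinuousWithinAt _
  have hco : ∀ M : ℝ, ∃ R : ℝ, 0 ≤ R ∧ ∀ v, R < v → (M : EReal) < dbeta β u v := by
    intro M
    obtain ⟨R, hR⟩ := eventually_atTop.1 (ht.eventually (eventually_gt_atTop M))
    refine ⟨max R 0, le_max_right _ _, fun v hv => ?_⟩
    rw [hd v ((le_max_right _ _).trans_lt hv)]
    exact EReal.coe_lt_coe_iff.2 (hR v ((le_max_left _ _).trans hv.le))
  refine ⟨L, hco, ?_⟩
  have hbot : ∀ v, 0 ≤ v → dbeta β u v ≠ ⊥ := by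
    intro v hv
    rcases hv.eq_or_lt with rfl | hv'
    · rcases h0 with ⟨h0, -⟩ | ⟨h0, -⟩ <;> simp [h0]
    · simp [hd v hv']
  obtain ⟨R, hR0, hR⟩ := hco 0
  obtain ⟨v0, hv0, hmin⟩ := LowerSemicontinuousOn.exists_isMinOn (nonempty_Icc.2 hR0)
    isCompact_Icc (L.mono (fun v hv => hv.1 : Icc 0 R ⊆ Ici 0))
  obtain ⟨B, -, hB⟩ := EReal.lt_iff_exists_real_btwn.1 (bot_lt_iff_ne_bot.2 (hbot v0 hv0.1))
  refine ⟨min B 0, fun v hv => ?_⟩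
  rcases le_or_gt v R with h | h
  · exact (EReal.coe_le_coe_iff.2 (min_le_left _ _)).trans (hB.le.trans (hmin ⟨hv, h⟩))
  · exact (EReal.coe_le_coe_iff.2 (min_le_right _ _)).trans (hR v h).le

lemma aux_sum_bot {ι : Type*} (s : Finset ι) (f : ι → EReal) (h : ∀ i ∈ s, f i ≠ ⊥) :
    ∑ i ∈ s, f i ≠ ⊥ := by
  classical
  induction s using Finset.induction_on with
  | empty => simp
  | insert i s hi ih =>
    rw [Finset.sum_insert hi, Ne, EReal.add_eq_bot_iff, not_or]
    exact ⟨h i (by simp), ih (fun j hj => h j (by simp [hj]))⟩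

lemma aux_sum_lsc {X ι : Type*} [TopologicalSpace X] (S : Set X) (s : Finset ι)
    (f : ι → X → EReal) (h : ∀ i, ∀ x ∈ S, f i x ≠ ⊥)
    (hl : ∀ i, LowerSemicontinuousOn (f i) S) :
    LowerSemicontinuousOn (fun x => ∑ i ∈ s, f i x) S := by
  classical
  induction s using Finset.induction_on with
  | empty => simpa using lowerSemicontinuousOn_const
  | insert i s hi ih =>
    simp_rw [Finset.sum_insert hi]
    refine (hl i).add' ih (fun x hx => ?_)
    exact EReal.continuousAt_add (Or.inr (aux_sum_bot _ _ (fun j _ => h j x hx)))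
      (Or.inl (h i x hx))

/-- Coercivity of the sum. -/
lemma aux_coer {m : ℕ} (β : ℝ) (y : Fin m → ℝ) (hy : ∀ i, 0 ≤ y i)
    (hβ : β ∈ Icc (0:ℝ) 2) (hy0 : β = 0 → ∀ i, 0 < y i) (c : ℝ) :
    ∃ R : ℝ, 0 ≤ R ∧ ∀ w : Fin m → ℝ, (∀ i, 0 ≤ w i) → Dbeta β y w ≤ c → ∀ i, w i ≤ R := by
  have H := fun i => aux_lsc β (y i) hβ (hy i) (fun h => hy0 h i)
  choose B hB using fun i => (H i).2.2
  choose R hR0 hR using fun i => (H i).2.1 (c - ∑ j ∈ Finset.univ.erase i, B j)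
  refine ⟨∑ i, R i, Finset.sum_nonneg (fun i _ => hR0 i), fun w hw hD i => ?_⟩
  refine le_trans ?_ (Finset.single_le_sum (fun i _ => hR0 i) (Finset.mem_univ i))
  by_contra hlt
  push Not at hlt
  refine absurd hD (not_le.2 ?_)
  have h1 := hR i (w i) hlt
  have h2 : ((∑ j ∈ Finset.univ.erase i, B j : ℝ) : EReal) ≤
      ∑ j ∈ Finset.univ.erase i, dbeta β (y j) (w j) := by
    have h3 : ∀ s : Finset (Fin m), ((∑ j ∈ s, B j : ℝ) : EReal) = ∑ j ∈ s, (B j : EReal) :=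
      fun s => map_sum (⟨⟨fun r : ℝ => (r : EReal), EReal.coe_zero⟩, EReal.coe_add⟩ : ℝ →+ EReal) B s
    rw [h3]
    exact Finset.sum_le_sum (fun j _ => hB j _ (hw j))
  unfold Dbeta
  rw [← Finset.add_sum_erase _ _ (Finset.mem_univ i)]
  set b := ∑ j ∈ Finset.univ.erase i, B j
  calc (c : EReal) = ((c - b : ℝ) : EReal) + (b : EReal) := by
        rw [← EReal.coe_add]; simp
    _ < dbeta β (y i) (w i) + (b : EReal) := EReal.add_lt_add_right_coe h1 b
    _ ≤ _ := add_le_add_right h2 _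

open Filter Topology in
lemma aux_main {m : ℕ} (hm : 1 ≤ m) {X : Type*} [TopologicalSpace X] [CompactSpace X]
    [MeasurableSpace X] [BorelSpace X] [CompactSpace (ProbabilityMeasure X)]
    (a : Fin m → C(X, ℝ)) (ha0 : ∀ i x, 0 ≤ a i x) (hne : Nonempty X)
    (y : Fin m → ℝ) (hy : ∀ i, 0 ≤ y i)
    (β : ℝ) (hβ : β ∈ Icc (0:ℝ) 2)
    (hpos : ∀ x : X, 0 < ∑ i, a i x)
    (hy0 : β = 0 → ∀ i, 0 < y i) :
    ∃ μ : Measure X, IsFiniteMeasure μ ∧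
      ∀ ν : Measure X, IsFiniteMeasure ν →
        Dbeta β y (fun i => ∫ x, a i x ∂μ) ≤ Dbeta β y (fun i => ∫ x, a i x ∂ν) := by
  by_cases htop : ∀ ν : Measure X, IsFiniteMeasure ν → Dbeta β y (fun i => ∫ x, a i x ∂ν) = ⊤
  · refine ⟨0, inferInstance, fun ν hν => ?_⟩
    rw [htop ν hν]
    exact le_top
  push Not at htop
  obtain ⟨ν0, hν0, hfin⟩ := htop
  obtain ⟨c, hc, -⟩ := EReal.lt_iff_exists_real_btwn.1 (lt_top_iff_ne_top.2 hfin)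
  obtain ⟨R, hR0, hR⟩ := aux_coer β y hy hβ hy0 c
  have H := fun i => aux_lsc β (y i) hβ (hy i) (fun h => hy0 h i)
  have hcont : Continuous (fun x : X => ∑ i, a i x) := by fun_prop
  obtain ⟨x0, -, hx0⟩ := isCompact_univ.exists_isMinOn (univ_nonempty (α := X)) hcont.continuousOn
  set δ := ∑ i, a i x0 with hδ
  have hδ0 : 0 < δ := hpos x0
  have hint : ∀ (ν : Measure X) (_ : IsFiniteMeasure ν) (i : Fin m),
      Integrable (fun x => a i x) ν := fun ν _ i =>
    (a i).continuous.integrable_of_hasCompactSupport (HasCompactSupport.of_compactSpace _)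
  have hmass : ∀ (ν : Measure X), IsFiniteMeasure ν →
      δ * ν.real univ ≤ ∑ i, ∫ x, a i x ∂ν := by
    intro ν hν
    rw [← integral_finset_sum _ (fun i _ => hint ν hν i)]
    have h1 : ∫ x : X, δ ∂ν ≤ ∫ x, ∑ i, a i x ∂ν :=
      integral_mono (integrable_const _) (integrable_finset_sum _ (fun i _ => hint ν hν i))
        (fun x => hx0 (mem_univ x))
    simpa [mul_comm] using h1
  set T : ℝ := m * R / δ with hT
  have hT0 : 0 ≤ T := by positivity
  let P0 : ProbabilityMeasure X := ⟨Measure.dirac hne.some, inferInstance⟩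
  let S : Set (ℝ × ProbabilityMeasure X) := Icc 0 T ×ˢ univ
  let w : Fin m → ℝ × ProbabilityMeasure X → ℝ := fun i q => q.1 * ∫ x, a i x ∂(q.2 : Measure X)
  have hwc : ∀ i, Continuous (w i) := by
    intro i
    refine continuous_fst.mul ?_
    have h1 : Continuous (fun P : ProbabilityMeasure X => ∫ x, a i x ∂(P : Measure X)) := by
      refine continuous_iff_continuousAt.2 (fun P => ?_)
      exact (ProbabilityMeasure.tendsto_iff_forall_integral_tendsto.1 tendsto_id)
        (BoundedContinuousFunction.mkOfCompact (a i))
    exact h1.comp continuous_snd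
  have hw0 : ∀ i, ∀ q ∈ S, 0 ≤ w i q := fun i q hq =>
    mul_nonneg hq.1.1 (integral_nonneg (fun x => ha0 i x))
  have hS : IsCompact S := isCompact_Icc.prod isCompact_univ
  have hbot : ∀ i v, 0 ≤ v → dbeta β (y i) v ≠ ⊥ := by
    intro i v hv
    obtain ⟨B, hB⟩ := (H i).2.2
    exact ((EReal.bot_lt_coe B).trans_le (hB v hv)).ne'
  have hlsc : LowerSemicontinuousOn (fun q => Dbeta β y (fun i => w i q)) S := by
    unfold Dbeta
    refine aux_sum_lsc S Finset.univ (fun i q => dbeta β (y i) (w i q))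
      (fun i q hq => hbot i _ (hw0 i q hq)) (fun i q hq z hz => ?_)
    have h1 := (H i).1 (w i q) (hw0 i q hq) z hz
    have h2 : Tendsto (w i) (𝓝[S] q) (𝓝[Ici 0] (w i q)) :=
      (hwc i).continuousWithinAt.tendsto_nhdsWithin (fun q hq => hw0 i q hq)
    exact h2.eventually h1
  obtain ⟨q, hq, hmin⟩ := LowerSemicontinuousOn.exists_isMinOn
    (show S.Nonempty from ⟨(0, P0), ⟨⟨le_rfl, hT0⟩, mem_univ _⟩⟩) hS hlsc
  have hle : ∀ ν : Measure X, IsFiniteMeasure ν → Dbeta β y (fun i => ∫ x, a i x ∂ν) ≤ c →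
      Dbeta β y (fun i => w i q) ≤ Dbeta β y (fun i => ∫ x, a i x ∂ν) := by
    intro ν hν hνc
    have h1 := hR _ (fun i => integral_nonneg (fun x => ha0 i x)) hνc
    have h2 : ν.real univ ≤ T := by
      rw [hT, le_div_iff₀ hδ0, mul_comm]
      refine (hmass ν hν).trans ?_
      refine (Finset.sum_le_sum (fun i _ => h1 i)).trans ?_
      simp
    obtain ⟨P, hP⟩ : ∃ P : ProbabilityMeasure X, ∀ i,
        w i (ν.real univ, P) = ∫ x, a i x ∂ν := by
      by_cases hz : ν = 0
      · refine ⟨P0, fun i => ?_⟩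
        simp [w, hz]
      · have : NeZero ν := ⟨hz⟩
        refine ⟨⟨(ν univ)⁻¹ • ν, inferInstance⟩, fun i => ?_⟩
        have h3 : ν.real univ ≠ 0 := by
          simp [measureReal_def, ENNReal.toReal_eq_zero_iff, hz]
        simp only [w, ProbabilityMeasure.coe_mk, integral_smul_measure, ENNReal.toReal_inv,
          smul_eq_mul, ← measureReal_def]
        field_simp
    have h4 := hmin (show (ν.real univ, P) ∈ S from ⟨⟨measureReal_nonneg, h2⟩, mem_univ _⟩)
    simpa only [mem_setOf_eq, hP] using h4
  refine ⟨ENNReal.ofReal q.1 • (q.2 : Measure X), (q.2 : Measure X).smul_finite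
    ENNReal.ofReal_ne_top, fun ν hν => ?_⟩
  have hq' : (fun i => ∫ x, a i x ∂(ENNReal.ofReal q.1 • (q.2 : Measure X))) =
      fun i => w i q := by
    funext i
    rw [integral_smul_measure, ENNReal.toReal_ofReal hq.1.1, smul_eq_mul]
  rw [hq']
  rcases le_or_gt (Dbeta β y (fun i => ∫ x, a i x ∂ν)) c with h | h
  · exact hle ν hν h
  · exact (hle ν0 hν0 hc.le).trans (hc.le.trans h.le)

/-- The infimum of ℓ(μ) = D_β(y|Aμ) over μ ∈ M₊(K) is attained. -/
theorem stmt0 {p m : ℕ} (hp : 1 ≤ p) (hm : 1 ≤ m)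
    (K : Set (EuclideanSpace ℝ (Fin p))) (hK : IsCompact K)
    (a : Fin m → C(K, ℝ)) (ha0 : ∀ i x, 0 ≤ a i x) (hane : ∀ i, ∃ x, a i x ≠ 0)
    (y : Fin m → ℝ) (hy : ∀ i, 0 ≤ y i)
    (β : ℝ) (hβ : β ∈ Icc (0:ℝ) 2)
    (hpos : ∀ x : K, 0 < ∑ i, a i x)
    (hy0 : β = 0 → ∀ i, 0 < y i) :
    ∃ μ : Measure K, IsFiniteMeasure μ ∧
      ∀ ν : Measure K, IsFiniteMeasure ν →
        Dbeta β y (fun i => ∫ x, a i x ∂μ) ≤ Dbeta β y (fun i => ∫ x, a i x ∂ν) := by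
  have : CompactSpace K := isCompact_iff_compactSpace.1 hK
  obtain ⟨x, -⟩ := hane ⟨0, hm⟩
  exact aux_main hm a ha0 ⟨x⟩ y hy β hβ hpos hy0
end

section
/- Assume that Σ_{i=1}^m a_i(x) > 0 for every x ∈ K. Then C = {Aμ : μ ∈ M₊(K)} is a closed convex cone in ℝ^m, i.e., C is closed, convex, and satisfies t·w ∈ C for every w ∈ C and every t ≥ 0. -/
open MeasureTheory Real Set

/-- C = {Aμ : μ ∈ M₊(K)} is a closed convex cone in ℝ^m. -/
theorem stmt1 {p m : ℕ} (hp : 1 ≤ p) (hm : 1 ≤ m)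
    (K : Set (EuclideanSpace ℝ (Fin p))) (hK : IsCompact K)
    (a : Fin m → C(K, ℝ)) (ha0 : ∀ i x, 0 ≤ a i x) (hane : ∀ i, ∃ x, a i x ≠ 0)
    (hpos : ∀ x : K, 0 < ∑ i, a i x)
    (C : Set (Fin m → ℝ))
    (hC : C = {w | ∃ μ : Measure K, IsFiniteMeasure μ ∧ w = fun i => ∫ x, a i x ∂μ}) :
    IsClosed C ∧ Convex ℝ C ∧ ∀ w ∈ C, ∀ t : ℝ, 0 ≤ t → t • w ∈ C := by
  classical
  have : CompactSpace K := isCompact_iff_compactSpace.mp hK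
  have hint : ∀ (μ : Measure K) [IsFiniteMeasure μ] (i : Fin m), Integrable (fun x => a i x) μ := by
    intro μ _ i
    exact (a i).continuous.integrable_of_hasCompactSupport (HasCompactSupport.of_compactSpace _)
  have hsmul : ∀ w ∈ C, ∀ t : ℝ, 0 ≤ t → t • w ∈ C := by
    subst hC
    rintro w ⟨μ, hμ, rfl⟩ t ht
    refine ⟨t.toNNReal • μ, inferInstance, ?_⟩
    ext i
    rw [integral_smul_nnreal_measure]
    simp [NNReal.smul_def, ht]
  have hadd : ∀ w ∈ C, ∀ v ∈ C, w + v ∈ C := by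
    subst hC
    rintro w ⟨μ, hμ, rfl⟩ v ⟨ν, hν, rfl⟩
    refine ⟨μ + ν, inferInstance, ?_⟩
    ext i
    rw [integral_add_measure (hint μ i) (hint ν i)]
    rfl
  have hconv : Convex ℝ C := fun x hx y hy s t hs ht _ =>
    hadd _ (hsmul x hx s hs) _ (hsmul y hy t ht)
  refine ⟨?_, hconv, hsmul⟩
  set H : Set (Fin m → ℝ) :=
    range (fun (P : ProbabilityMeasure K) (i : Fin m) => ∫ x, a i x ∂(P : Measure K)) with hHdef
  have hH : IsCompact H := by
    refine isCompact_range (continuous_pi fun i => ?_)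
    exact ProbabilityMeasure.continuous_integral_boundedContinuousFunction
      (BoundedContinuousFunction.mkOfCompact (a i))
  have hHC : H ⊆ C := by
    rintro _ ⟨P, rfl⟩
    rw [hC]
    exact ⟨P, inferInstance, rfl⟩
  have hHpos : ∀ v ∈ H, 0 < ∑ i, v i := by
    rintro _ ⟨P, rfl⟩
    show 0 < ∑ i, ∫ x, a i x ∂(P : Measure K)
    rw [← integral_finsetSum _ (fun i _ => hint _ i),
      integral_pos_iff_support_of_nonneg (fun x => (hpos x).le)
        (integrable_finsetSum _ (fun i _ => hint _ i))]
    have : Function.support (fun x : K => ∑ i, a i x) = univ := by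
      ext x; simpa using (hpos x).ne'
    rw [this]; simp
  have hrep : ∀ w ∈ C, ∃ v ∈ H, w = ((∑ i, w i) / ∑ i, v i) • v ∧ 0 ≤ ∑ i, w i := by
    intro w hw
    have hw' := hw
    rw [hC] at hw'
    obtain ⟨μ, hμ, hwμ⟩ := hw'
    have h0 : 0 ≤ ∑ i, w i := by
      rw [hwμ]
      exact Finset.sum_nonneg fun i _ => integral_nonneg (ha0 i)
    obtain ⟨x0, -⟩ := hane ⟨0, hm⟩
    by_cases hz : μ = 0
    · refine ⟨_, ⟨⟨Measure.dirac x0, inferInstance⟩, rfl⟩, ?_, h0⟩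
      subst hz
      have : w = 0 := by rw [hwμ]; ext i; simp
      simp [this]
    · have : NeZero μ := ⟨hz⟩
      have hav : (μ.real univ)⁻¹ • w ∈ H := by
        refine ⟨⟨(μ univ)⁻¹ • μ, inferInstance⟩, ?_⟩
        ext i
        simp [hwμ, integral_smul_measure, Measure.real]
      refine ⟨_, hav, ?_, h0⟩
      have hp := hHpos _ hav
      have hr : (μ.real univ)⁻¹ ≠ 0 := by
        intro h; rw [h] at hp; simp at hp
      simp only [Pi.smul_apply, smul_eq_mul, ← Finset.mul_sum] at hp ⊢
      have hs : (∑ i, w i) ≠ 0 := by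
        intro h; rw [h] at hp; simp at hp
      rw [smul_smul]
      have : (∑ i, w i) / ((μ.real univ)⁻¹ * ∑ i, w i) * (μ.real univ)⁻¹ = 1 := by
        generalize (μ.real univ)⁻¹ = r at *
        field_simp
      rw [this, one_smul]
  refine isClosed_of_closure_subset fun w hw => ?_
  obtain ⟨u, huC, hu⟩ := mem_closure_iff_seq_limit.mp hw
  choose v hvH hv hn using fun n => hrep (u n) (huC n)
  obtain ⟨v0, hv0, φ, hφ, hlim⟩ := hH.tendsto_subseq hvH
  have hsum : Continuous fun z : Fin m → ℝ => ∑ i, z i := by fun_prop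
  have h1 := (hsum.tendsto w).comp (hu.comp hφ.tendsto_atTop)
  have h2 := (hsum.tendsto v0).comp hlim
  have h3 := (h1.div h2 (hHpos _ hv0).ne').smul hlim
  have h4 : w = ((∑ i, w i) / ∑ i, v0 i) • v0 := by
    refine tendsto_nhds_unique (hu.comp hφ.tendsto_atTop) (h3.congr fun n => ?_)
    exact (hv (φ n)).symm
  rw [h4]
  refine hsmul _ (hHC hv0) _ (div_nonneg ?_ (hHpos _ hv0).le)
  exact ge_of_tendsto' h1 fun n => hn (φ n)
end

section
/- Let β ∈ [1,2] and let μ̄ ∈ M₊(K) satisfy supp(y) ⊆ supp(Aμ̄) in the case β < 2. If A*λ(μ̄)(x) ≥ 0 for every x ∈ K and A*λ(μ̄)(x) = 0 for every x ∈ supp(μ̄), then μ̄ is a minimizer of ℓ over M₊(K). -/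
open MeasureTheory Real Set

lemma pow_tangent (β u w v : ℝ) (h1 : 1 < β) (h2 : β ≤ 2) (hu : 0 ≤ u) (hw : 0 < w) (hv : 0 ≤ v) :
    (u ^ β + (β - 1) * w ^ β - β * u * w ^ (β - 1)) / (β * (β - 1))
      + (w ^ (β - 2) * (w - u)) * (v - w)
      ≤ (u ^ β + (β - 1) * v ^ β - β * u * v ^ (β - 1)) / (β * (β - 1)) := by
  obtain ⟨t, ht, rfl⟩ : ∃ t : ℝ, 0 ≤ t ∧ v = t * w := ⟨v / w, by positivity, by field_simp⟩
  have hT1 := one_add_mul_self_le_rpow_one_add (s := t - 1) (by linarith) h1.le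
  have hT2 := rpow_one_add_le_one_add_mul_self (s := t - 1) (by linarith) (p := β - 1)
    (by linarith) (by linarith)
  rw [add_sub_cancel] at hT1 hT2
  rw [Real.mul_rpow ht hw.le, Real.mul_rpow ht hw.le]
  have e1 : w ^ (β - 1) = w ^ (β - 2) * w := by
    rw [← Real.rpow_add_one hw.ne']; congr 1; ring
  have e2 : w ^ β = w ^ (β - 2) * w * w := by
    rw [← e1, ← Real.rpow_add_one hw.ne']; congr 1; ring
  rw [e1, e2]
  have hW : 0 < w ^ (β - 2) := Real.rpow_pos_of_pos hw _
  generalize w ^ (β - 2) = W at *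
  generalize t ^ β = T1 at *
  generalize t ^ (β - 1) = T2 at *
  generalize u ^ β = X at *
  have hb : 0 < β * (β - 1) := mul_pos (by linarith) (by linarith)
  rw [le_div_iff₀ hb, add_mul, div_mul_cancel₀ _ hb.ne']
  have A : 0 ≤ (β - 1) * (W * w * w) * (T1 - (1 + β * (t - 1))) :=
    mul_nonneg (mul_nonneg (by linarith) (by positivity)) (by linarith)
  have B : 0 ≤ β * u * (W * w) * ((1 + (β - 1) * (t - 1)) - T2) :=
    mul_nonneg (mul_nonneg (mul_nonneg (by linarith) hu) (by positivity)) (by linarith)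
  linear_combination A + B

lemma scalar_tangent (β u w : ℝ) (hβ : β ∈ Icc (1:ℝ) 2) (hu : 0 ≤ u) (hw : 0 ≤ w)
    (hreg : β < 2 → 0 < u → 0 < w) (l : ℝ)
    (hl : l = if 0 < w then w ^ (β - 2) * (w - u) else if β = 2 then -u else 0) :
    ∃ c : ℝ, dbeta β u w = (c : EReal) ∧
      ∀ v : ℝ, 0 ≤ v → ((c + l * (v - w) : ℝ) : EReal) ≤ dbeta β u v := by
  obtain ⟨h1, h2⟩ := hβ
  have h0 : β ≠ 0 := by linarith
  rcases h1.eq_or_lt with rfl | h1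
  · have hn : ¬ (w = 0 ∧ 0 < u) := by
      rintro ⟨h, h'⟩
      exact (hreg (by norm_num) h').ne' h
    refine ⟨w - u - u * Real.log (w / u), by simp only [dbeta]; simp [hn], ?_⟩
    intro v hv
    by_cases hvu : v = 0 ∧ 0 < u
    · simp [dbeta, hvu]
    have : dbeta 1 u v = ((v - u - u * Real.log (v / u) : ℝ) : EReal) := by
      simp only [dbeta]; simp [hvu]
    rw [this, EReal.coe_le_coe_iff]
    rcases hu.eq_or_lt with rfl | hu
    · rcases hw.eq_or_lt with rfl | hw
      · simp at hl; simp [hl, hv]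
      · rw [if_pos hw] at hl
        have : w ^ ((1:ℝ) - 2) = w⁻¹ := by rw [← Real.rpow_neg_one]; norm_num
        rw [this, sub_zero, inv_mul_cancel₀ hw.ne'] at hl
        subst hl; simp
    · have hw := hreg (by norm_num) hu
      have hv : 0 < v := hv.lt_of_ne (fun h => hvu ⟨h.symm, hu⟩)
      rw [if_pos hw] at hl
      have : w ^ ((1:ℝ) - 2) = w⁻¹ := by rw [← Real.rpow_neg_one]; norm_num
      rw [this] at hl
      have hlog := Real.log_le_sub_one_of_pos (div_pos hv hw)
      rw [Real.log_div hv.ne' hw.ne'] at hlog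
      rw [Real.log_div hv.ne' hu.ne', Real.log_div hw.ne' hu.ne', hl]
      have := mul_le_mul_of_nonneg_left hlog hu.le
      have e : w⁻¹ * (w - u) * (v - w) = v - w - u * (v / w - 1) := by field_simp
      rw [e]; linarith
  · have e : ∀ v, dbeta β u v = (((u ^ β + (β - 1) * v ^ β - β * u * v ^ (β - 1)) / (β * (β - 1)) : ℝ) : EReal) := by
      intro v
      simp [dbeta, h0, h1.ne', not_lt.2 h1.le]
    refine ⟨_, e w, ?_⟩
    intro v hv
    rw [e, EReal.coe_le_coe_iff]
    rcases hw.eq_or_lt with rfl | hw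
    · rw [if_neg (lt_irrefl _)] at hl
      have hb : 0 < β * (β - 1) := mul_pos (by linarith) (by linarith)
      rw [Real.zero_rpow h0, Real.zero_rpow (by linarith : β - 1 ≠ 0)]
      by_cases h : β = 2
      · subst h
        simp at hl
        subst hl
        norm_num
        nlinarith [sq_nonneg v]
      · have hu0 : u = 0 := by
          by_contra hne
          exact lt_irrefl _ (hreg (lt_of_le_of_ne h2 h) (lt_of_le_of_ne hu (Ne.symm hne)))
        rw [if_neg h] at hl
        subst hl hu0
        have : 0 ≤ (β - 1) * v ^ β / (β * (β - 1)) :=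
          div_nonneg (mul_nonneg (by linarith) (Real.rpow_nonneg hv _)) hb.le
        simpa [Real.zero_rpow h0] using this
    · rw [hl, if_pos hw]
      exact pow_tangent β u w v h1 h2 hu hw hv

lemma ereal_coe_sum {m : ℕ} (f : Fin m → ℝ) : ((∑ i, f i : ℝ) : EReal) = ∑ i, (f i : EReal) := by
  induction (Finset.univ : Finset (Fin m)) using Finset.induction_on with
  | empty => simp
  | insert a s h ih => rw [Finset.sum_insert h, Finset.sum_insert h, EReal.coe_add, ih]

/-- For β ∈ [1,2], the KKT conditions are sufficient for optimality. -/
theorem stmt5 {p m : ℕ} (hp : 1 ≤ p) (hm : 1 ≤ m)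
    (K : Set (EuclideanSpace ℝ (Fin p))) (hK : IsCompact K)
    (a : Fin m → C(K, ℝ)) (ha0 : ∀ i x, 0 ≤ a i x) (hane : ∀ i, ∃ x, a i x ≠ 0)
    (y : Fin m → ℝ) (hy : ∀ i, 0 ≤ y i)
    (β : ℝ) (hβ : β ∈ Icc (1:ℝ) 2)
    (μbar : Measure K) (hμbar : IsFiniteMeasure μbar)
    (w : Fin m → ℝ) (hw : w = fun i => ∫ x, a i x ∂μbar)
    (hreg : β < 2 → ∀ i, 0 < y i → 0 < w i)
    (hKKT₁ : ∀ x : K, 0 ≤ ∑ i, lamvec β y w i * a i x)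
    (hKKT₂ : ∀ x : K, (∀ U : Set K, IsOpen U → x ∈ U → 0 < μbar U) →
      ∑ i, lamvec β y w i * a i x = 0) :
    ∀ ν : Measure K, IsFiniteMeasure ν →
      Dbeta β y w ≤ Dbeta β y (fun i => ∫ x, a i x ∂ν) := by
  intro ν hν
  haveI : CompactSpace K := isCompact_iff_compactSpace.1 hK
  have hint : ∀ (ρ : Measure K), IsFiniteMeasure ρ → ∀ i, Integrable (fun x => a i x) ρ := by
    intro ρ hρ i
    exact (a i).continuous.integrable_of_hasCompactSupport
      (HasCompactSupport.of_compactSpace _)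
  have hsum : ∀ (ρ : Measure K), IsFiniteMeasure ρ → 
      ∫ x, ∑ i, lamvec β y w i * a i x ∂ρ = ∑ i, lamvec β y w i * ∫ x, a i x ∂ρ := by
    intro ρ hρ
    rw [integral_finset_sum _ (fun i _ => (hint ρ hρ i).const_mul _)]
    simp_rw [integral_const_mul]
  have hν0 : 0 ≤ ∑ i, lamvec β y w i * ∫ x, a i x ∂ν := by
    rw [← hsum ν hν]
    exact integral_nonneg hKKT₁
  have hμ0 : ∑ i, lamvec β y w i * w i = 0 := by
    have : ∑ i, lamvec β y w i * w i = ∑ i, lamvec β y w i * ∫ x, a i x ∂μbar := by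
      simp [congrFun hw]
    rw [this, ← hsum μbar hμbar]
    apply integral_eq_zero_of_ae
    have hs : μbar.support ∈ ae μbar := Measure.support_mem_ae
    filter_upwards [hs] with x hx
    apply hKKT₂ x
    intro U hU hxU
    exact (Measure.mem_support_iff_forall x).1 hx U (hU.mem_nhds hxU)
  have hw0 : ∀ i, 0 ≤ w i := by
    intro i; rw [hw]; exact integral_nonneg (ha0 i)
  choose c hc hcv using fun i => scalar_tangent β (y i) (w i) hβ (hy i) (hw0 i)
    (fun h => hreg h i) (lamvec β y w i) rfl
  unfold Dbeta
  calc ∑ i, dbeta β (y i) (w i) = ((∑ i, c i : ℝ) : EReal) := by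
        rw [ereal_coe_sum]; exact Finset.sum_congr rfl (fun i _ => hc i)
    _ ≤ ((∑ i, (c i + lamvec β y w i * ((∫ x, a i x ∂ν) - w i)) : ℝ) : EReal) := by
        rw [EReal.coe_le_coe_iff, Finset.sum_add_distrib]
        simp_rw [mul_sub]
        rw [Finset.sum_sub_distrib, hμ0]
        linarith
    _ ≤ _ := by
        rw [ereal_coe_sum]
        exact Finset.sum_le_sum (fun i _ => hcv i _ (integral_nonneg (ha0 i)))
end

section
/- Fix β ∈ [0,2] and u > 0. The function v ↦ d_β(u|v), viewed as a map from [0,∞) to [0,+∞], is convex if and only if β ∈ [1,2]. -/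
open MeasureTheory Real Set

open Filter Topology in
lemma no_conv (F : ℝ → ℝ)
    (hc : ∀ v₁ > 0, ∀ v₂ > 0, ∀ t ∈ Icc (0:ℝ) 1,
      F (t * v₁ + (1 - t) * v₂) ≤ t * F v₁ + (1 - t) * F v₂)
    (h0 : Tendsto (fun v => F v / v) atTop (𝓝 0)) (h1 : Tendsto F atTop atTop) : False := by
  obtain ⟨s, hs, hs1⟩ := ((h1.eventually_gt_atTop (F 1)).and (eventually_gt_atTop 1)).exists
  have hc0 : 0 < F s - F 1 := by linarith
  have hs0 : 0 < s - 1 := by linarith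
  set c := F s - F 1 with hcdef
  have he : 0 < c / (2 * (s - 1)) := by positivity
  obtain ⟨N, hN, hNs, hN2⟩ := ((h0.eventually_lt_const he).and ((eventually_gt_atTop s).and
    (eventually_gt_atTop (2 * (c - (s - 1) * F 1) / c)))).exists
  have hNp : 0 < N := by linarith
  have hN1 : 0 < N - 1 := by linarith
  have h := hc N hNp 1 one_pos ((s - 1) / (N - 1))
    ⟨by positivity, by rw [div_le_one hN1]; linarith⟩
  have e : (s - 1) / (N - 1) * N + (1 - (s - 1) / (N - 1)) * 1 = s := by field_simp; ring
  rw [e] at h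
  have h' : c ≤ (s - 1) / (N - 1) * (F N - F 1) := by linarith
  rw [div_mul_eq_mul_div, le_div_iff₀ hN1] at h'
  rw [div_lt_iff₀ hNp] at hN
  rw [div_lt_iff₀ hc0] at hN2
  have : (s - 1) * F N < (s - 1) * (c / (2 * (s - 1)) * N) := by gcongr
  have e2 : (s - 1) * (c / (2 * (s - 1)) * N) = c * N / 2 := by field_simp
  nlinarith

/-- For u > 0, v ↦ d_β(u|v) is convex on [0,∞) iff β ∈ [1,2]. -/
theorem stmt14 (β u : ℝ) (hβ : β ∈ Icc (0:ℝ) 2) (hu : 0 < u) :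
    (∀ v₁ ∈ Ici (0:ℝ), ∀ v₂ ∈ Ici (0:ℝ), ∀ t ∈ Icc (0:ℝ) 1,
      dbeta β u (t * v₁ + (1 - t) * v₂) ≤
        ((t : ℝ) : EReal) * dbeta β u v₁ + (((1 - t : ℝ)) : EReal) * dbeta β u v₂)
    ↔ β ∈ Icc (1:ℝ) 2 := by
  have hpos : ∀ v₁ > (0:ℝ), ∀ v₂ > (0:ℝ), ∀ t ∈ Icc (0:ℝ) 1, 0 < t * v₁ + (1 - t) * v₂ := by
    intro v₁ h₁ v₂ h₂ t ht
    rcases ht.1.eq_or_lt with h | h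
    · subst h; simpa using h₂
    · have := mul_pos h h₁
      have := mul_nonneg (sub_nonneg.2 ht.2) h₂.le
      linarith
  constructor
  · intro H
    refine ⟨?_, hβ.2⟩
    by_contra! hlt
    have key : ∀ F : ℝ → ℝ, (∀ v > 0, dbeta β u v = (F v : EReal)) →
        Filter.Tendsto (fun v => F v / v) Filter.atTop (nhds 0) →
        Filter.Tendsto F Filter.atTop Filter.atTop → False := by
      intro F hF q0 q1
      refine no_conv F ?_ q0 q1
      intro v₁ h₁ v₂ h₂ t ht
      have := H v₁ h₁.le v₂ h₂.le t ht
      rw [hF _ h₁, hF _ h₂, hF _ (hpos _ h₁ _ h₂ t ht)] at this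
      exact_mod_cast this
    rcases hβ.1.eq_or_lt with h0 | h0
    · subst h0
      refine key (fun v => u * v⁻¹ + Real.log v + (- Real.log u - 1)) ?_ ?_ ?_
      · intro v hv
        simp only [dbeta, hu.ne', hv.ne', if_true, or_self, if_false]
        congr 1
        rw [Real.log_div hu.ne' hv.ne']; ring
      · have a := (tendsto_inv_atTop_zero (𝕜 := ℝ))
        have b : Filter.Tendsto (fun v : ℝ => Real.log v / v) Filter.atTop (nhds 0) := by
          simpa using Real.isLittleO_log_id_atTop.tendsto_div_nhds_zero
        have := (((a.mul a).const_mul u).add b).add (a.const_mul (- Real.log u - 1))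
        simp only [mul_zero, add_zero] at this
        refine this.congr fun v => ?_
        ring
      · exact ((((tendsto_inv_atTop_zero (𝕜 := ℝ)).const_mul u).add_atTop
          Real.tendsto_log_atTop)).atTop_add tendsto_const_nhds
    · have hb : β - 1 ≠ 0 := by linarith
      have hp : Filter.Tendsto (fun v : ℝ => v ^ (β - 1)) Filter.atTop (nhds 0) := by
        have := tendsto_rpow_neg_atTop (y := 1 - β) (by linarith)
        simpa using this
      refine key (fun v => u / (1 - β) * v ^ (β - 1) + β⁻¹ * v ^ β + u ^ β / (β * (β - 1)))
        ?_ ?_ ?_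
      · intro v hv
        simp only [dbeta, h0.ne', hlt.ne, hv.ne', hlt, if_true, false_and, if_false]
        congr 1
        have : 1 - β ≠ 0 := by linarith
        have e : u / (1 - β) = - (u / (β - 1)) := by rw [← div_neg]; congr 1; ring
        rw [e]
        field_simp
        ring
      · have a := (tendsto_inv_atTop_zero (𝕜 := ℝ))
        have := (((hp.mul a).const_mul (u / (1 - β))).add (hp.const_mul β⁻¹)).add
          (a.const_mul (u ^ β / (β * (β - 1))))
        simp only [mul_zero, add_zero] at this
        refine this.congr' ?_
        filter_upwards [Filter.eventually_gt_atTop 0] with v hv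
        have e : v ^ β = v ^ (β - 1) * v := by
          rw [← Real.rpow_add_one hv.ne']; congr 1; ring
        rw [e]
        field_simp
      · exact ((hp.const_mul _).add_atTop
          ((tendsto_rpow_atTop h0).const_mul_atTop (inv_pos.2 h0))).atTop_add tendsto_const_nhds
  · rintro ⟨h1, h2⟩ v₁ h₁ v₂ h₂ t ht
    simp only [mem_Ici] at h₁ h₂
    have ht' : 0 ≤ 1 - t := by linarith [ht.2]
    rcases h1.eq_or_lt with h | h
    · subst h
      have hval : ∀ v > 0, dbeta 1 u v = ((v - u - u * Real.log (v / u) : ℝ) : EReal) := by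
        intro v hv
        simp [dbeta, hv.ne']
      have hz : dbeta 1 u 0 = ⊤ := by simp [dbeta, hu]
      rcases ht.1.eq_or_lt with h0 | h0
      · subst h0; simp
      rcases ht'.eq_or_lt with h0' | h0'
      · have : t = 1 := by linarith
        subst this; simp
      rcases h₁.eq_or_lt with g | g
      · subst g
        rw [hz, EReal.coe_mul_top_of_pos h0, EReal.top_add_of_ne_bot]
        · exact le_top
        · rcases h₂.eq_or_lt with g | g
          · subst g
            rw [hz, EReal.coe_mul_top_of_pos h0']; simp
          · rw [hval _ g, ← EReal.coe_mul]; exact EReal.coe_ne_bot _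
      rcases h₂.eq_or_lt with g' | g'
      · subst g'
        rw [hz, EReal.coe_mul_top_of_pos h0', EReal.add_top_of_ne_bot]
        · exact le_top
        · rw [hval _ g, ← EReal.coe_mul]; exact EReal.coe_ne_bot _
      have hp := hpos _ g _ g' t ht
      rw [hval _ g, hval _ g', hval _ hp]
      norm_cast
      have := strictConcaveOn_log_Ioi.concaveOn.2 (mem_Ioi.2 g) (mem_Ioi.2 g') ht.1 ht' (by ring)
      simp only [smul_eq_mul] at this
      rw [Real.log_div hp.ne' hu.ne', Real.log_div g.ne' hu.ne', Real.log_div g'.ne' hu.ne']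
      have := mul_le_mul_of_nonneg_left this hu.le
      linarith
    · have hval : ∀ v, dbeta β u v = ((v ^ β * β⁻¹ - u * (β - 1)⁻¹ * v ^ (β - 1)
          + u ^ β / (β * (β - 1)) : ℝ) : EReal) := by
        intro v
        have h3 : β ≠ 0 := by linarith
        have h4 : β - 1 ≠ 0 := by linarith
        simp only [dbeta, h3, h.ne', not_lt.2 h.le, if_false]
        congr 1
        field_simp
        ring
      rw [hval, hval, hval]
      norm_cast
      have A := (convexOn_rpow h.le).2 (mem_Ici.2 h₁) (mem_Ici.2 h₂) ht.1 ht' (by ring)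
      have B := (Real.concaveOn_rpow (p := β - 1) (by linarith) (by linarith)).2
        (mem_Ici.2 h₁) (mem_Ici.2 h₂) ht.1 ht' (by ring)
      simp only [smul_eq_mul] at A B
      have A' := mul_le_mul_of_nonneg_right A (inv_nonneg.2 (by linarith : 0 ≤ β))
      have B' := mul_le_mul_of_nonneg_left B
        (mul_nonneg hu.le (inv_nonneg.2 (by linarith : 0 ≤ β - 1)))
      linarith
end

section
/- For every β ∈ [0,2] and every u ≥ 0, the function v ↦ d_β(u|v) is lower semicontinuous as a map from [0,∞) to [0,+∞]. -/
open MeasureTheory Real Set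

open Filter Topology in
lemma lsc_aux (f : ℝ → EReal) (g : ℝ → ℝ) (hf : ∀ v, 0 < v → f v = (g v : EReal))
    (hg : ContinuousOn g (Ioi 0)) (h0 : f 0 = ⊤) (ht : Tendsto g (𝓝[>] 0) atTop) :
    LowerSemicontinuousOn f (Ici (0:ℝ)) := by
  intro x hx y hy
  rcases eq_or_lt_of_le (mem_Ici.1 hx) with h | h
  · subst h
    rw [← Ioi_insert, nhdsWithin_insert, eventually_sup]
    refine ⟨by simpa using hy, ?_⟩
    rw [h0] at hy
    obtain ⟨c, hc, -⟩ := EReal.lt_iff_exists_real_btwn.1 hy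
    filter_upwards [ht.eventually_ge_atTop c, self_mem_nhdsWithin] with v hv hv0
    rw [hf v hv0]
    exact hc.trans_le (by exact_mod_cast hv)
  · apply mem_nhdsWithin_of_mem_nhds
    have hc : ContinuousAt (fun v => (g v : EReal)) x :=
      continuous_coe_real_ereal.continuousAt.comp (hg.continuousAt (Ioi_mem_nhds h))
    rw [hf x h] at hy
    filter_upwards [hc.eventually (lt_mem_nhds hy), Ioi_mem_nhds h] with v hv hv0
    rw [hf v hv0]; exact hv

lemma lsc_cont (f : ℝ → EReal) (g : ℝ → ℝ) (hf : ∀ v, 0 ≤ v → f v = (g v : EReal))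
    (hg : ContinuousOn g (Ici 0)) : LowerSemicontinuousOn f (Ici (0:ℝ)) := by
  have : ContinuousOn f (Ici 0) :=
    (continuous_coe_real_ereal.comp_continuousOn hg).congr (fun v hv => hf v hv)
  exact this.lowerSemicontinuousOn

open Filter Topology in
/-- For every β ∈ [0,2] and u ≥ 0, v ↦ d_β(u|v) is lower
semicontinuous on [0,∞). -/
theorem stmt15 (β u : ℝ) (hβ : β ∈ Icc (0:ℝ) 2) (hu : 0 ≤ u) :
    LowerSemicontinuousOn (fun v => dbeta β u v) (Ici (0:ℝ)) := by
  obtain ⟨hb0, hb2⟩ := hβ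
  by_cases h0 : β = 0
  · subst h0
    rcases hu.eq_or_lt with h | h
    · subst h
      simp only [dbeta, if_true, true_or]
      exact lowerSemicontinuousOn_const
    · apply lsc_aux _ (fun v => u / v - Real.log (u / v) - 1)
      · intro v hv; simp [dbeta, h.ne', hv.ne']
      · have h1 : ContinuousOn (fun v : ℝ => u / v) (Ioi 0) :=
          continuousOn_const.div continuousOn_id (fun v hv => ne_of_gt hv)
        exact (h1.sub (h1.log (fun v hv => (div_pos h hv).ne'))).sub continuousOn_const
      · simp [dbeta]
      · have h1 : Tendsto (fun v : ℝ => u / v) (𝓝[>] 0) atTop := by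
          simpa [div_eq_mul_inv] using tendsto_inv_nhdsGT_zero.const_mul_atTop h
        have h2 : Tendsto (fun v : ℝ => (u / v) / 2 + - Real.log 2) (𝓝[>] 0) atTop :=
          tendsto_atTop_add_const_right _ _ (h1.atTop_div_const two_pos)
        refine tendsto_atTop_mono' _ ?_ h2
        filter_upwards [self_mem_nhdsWithin] with v hv
        have hx : 0 < u / v := div_pos h hv
        have := Real.log_le_sub_one_of_pos (half_pos hx)
        rw [Real.log_div hx.ne' two_ne_zero] at this
        linarith
  by_cases h1 : β = 1
  · subst h1
    rcases hu.eq_or_lt with h | h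
    · subst h
      apply lsc_cont _ (fun v => v)
      · intro v hv; simp [dbeta]
      · exact continuousOn_id
    · apply lsc_aux _ (fun v => v - u - u * Real.log (v / u))
      · intro v hv; simp [dbeta, hv.ne']
      · have h1 : ContinuousOn (fun v : ℝ => v / u) (Ioi 0) := continuousOn_id.div_const u
        exact (continuousOn_id.sub continuousOn_const).sub
          (continuousOn_const.mul (h1.log (fun v hv => (div_pos hv h).ne')))
      · simp [dbeta, h]
      · have h2 : Tendsto (fun v : ℝ => u * (- Real.log v) + (u * Real.log u - u)) (𝓝[>] 0) atTop :=
          tendsto_atTop_add_const_right _ _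
            ((tendsto_neg_atBot_atTop.comp Real.tendsto_log_nhdsGT_zero).const_mul_atTop h)
        refine tendsto_atTop_mono' _ ?_ h2
        filter_upwards [self_mem_nhdsWithin] with v hv
        have hv : 0 < v := hv
        rw [Real.log_div hv.ne' h.ne']
        linarith
  have hbp : 0 < β := lt_of_le_of_ne hb0 (Ne.symm h0)
  have hcb : Continuous (fun v : ℝ => v ^ β) := Real.continuous_rpow_const hb0
  by_cases hl : β < 1
  · rcases hu.eq_or_lt with h | h
    · subst h
      apply lsc_cont _ (fun v => ((0:ℝ) ^ β + (β - 1) * v ^ β) / (β * (β - 1)))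
      · intro v hv; simp [dbeta, h0, h1]
      · exact ((continuous_const.add (continuous_const.mul hcb)).div_const _).continuousOn
    · have hc1 : ContinuousOn (fun v : ℝ => v ^ (β - 1)) (Ioi 0) :=
        continuousOn_id.rpow_const (fun v hv => Or.inl (ne_of_gt hv))
      apply lsc_aux _
        (fun v => (u ^ β + (β - 1) * v ^ β - β * u * v ^ (β - 1)) / (β * (β - 1)))
      · intro v hv; simp [dbeta, h0, h1, hv.ne']
      · exact ((continuous_const.add (continuous_const.mul hcb)).continuousOn.sub
          (continuousOn_const.mul hc1)).div_const _
      · simp [dbeta, h0, h1, hl, h]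
      · have hA : Tendsto (fun v : ℝ => (u ^ β + (β - 1) * v ^ β) / (β * (β - 1))) (𝓝[>] 0)
            (𝓝 ((u ^ β + (β - 1) * (0:ℝ) ^ β) / (β * (β - 1)))) :=
          (((continuous_const.add (continuous_const.mul hcb)).div_const _).tendsto 0).mono_left
            nhdsWithin_le_nhds
        have hB : Tendsto (fun v : ℝ => v ^ (β - 1)) (𝓝[>] 0) atTop := by
          have := (tendsto_rpow_atTop (sub_pos.2 hl)).comp (tendsto_inv_nhdsGT_zero (𝕜 := ℝ))
          refine this.congr' ?_
          filter_upwards [self_mem_nhdsWithin] with v hv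
          have hv : 0 < v := hv
          simp only [Function.comp]
          rw [Real.inv_rpow hv.le, ← Real.rpow_neg hv.le, neg_sub]
        have hC := hA.add_atTop (hB.const_mul_atTop (div_pos h (sub_pos.2 hl)))
        refine hC.congr (fun v => ?_)
        have e1 : β - 1 ≠ 0 := sub_ne_zero.2 h1
        have e2 : (1:ℝ) - β ≠ 0 := sub_ne_zero.2 (Ne.symm h1)
        have : u / (1 - β) = - (u / (β - 1)) := by rw [← neg_sub β 1, div_neg]
        rw [this]
        field_simp
        ring
  · apply lsc_cont _
        (fun v => (u ^ β + (β - 1) * v ^ β - β * u * v ^ (β - 1)) / (β * (β - 1)))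
    · intro v hv; simp [dbeta, h0, h1, hl]
    · have hc1 : Continuous (fun v : ℝ => v ^ (β - 1)) :=
        Real.continuous_rpow_const (by linarith)
      exact (((continuous_const.add (continuous_const.mul hcb)).sub
        (continuous_const.mul hc1)).div_const _).continuousOn
end

section
/- Fix y > 0 and consider h(y,λ) := inf_{w ≥ 0} (d_0(y|w) − λw) for λ ∈ ℝ. Then: (i) if λ < 0, h(y,λ) = √(1−4λy) − log((√(1−4λy)+1)/2) − 1, and the infimum is attained uniquely at w = (√(1−4λy) − 1)/(−2λ), which is the unique w > 0 solving w^{−2}(w − y) = λ; (ii) if λ = 0, h(y,λ) = 0, attained uniquely at w = y; (iii) if λ > 0, h(y,λ) = −∞. -/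
open MeasureTheory Real Set

lemma aux_val (y l w : ℝ) (hy : 0 < y) (hw : 0 < w) :
    dbeta 0 y w - ((l * w : ℝ) : EReal) = ((y / w - Real.log (y / w) - 1 - l * w : ℝ) : EReal) := by
  have : ¬ (y = 0 ∨ w = 0) := by
    rintro (h | h) <;> linarith
  simp only [dbeta, if_true, if_neg this]
  rw [← EReal.coe_sub]

lemma aux_zero (y l : ℝ) :
    dbeta 0 y 0 - ((l * 0 : ℝ) : EReal) = ⊤ := by
  simp [dbeta]

lemma aux_lt (y l v w : ℝ) (hy : 0 < y) (hv : 0 < v) (hw : 0 < w) (hl : l ≤ 0)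
    (hs : v - y = l * v ^ 2) (hne : w ≠ v) :
    y / v - Real.log (y / v) - 1 - l * v < y / w - Real.log (y / w) - 1 - l * w := by
  have h1 : Real.log (v / w) < v / w - 1 := by
    apply Real.log_lt_sub_one_of_pos (by positivity)
    intro h
    rw [div_eq_one_iff_eq hw.ne'] at h
    exact hne h.symm
  rw [Real.log_div hv.ne' hw.ne'] at h1
  rw [Real.log_div hy.ne' hw.ne', Real.log_div hy.ne' hv.ne']
  have hy' : y = v - l * v ^ 2 := by linarith
  have e1 : y / v = 1 - l * v := by rw [hy']; field_simp
  have e2 : y / w = v / w - l * v * (v / w) := by rw [hy']; field_simp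
  rw [e1, e2]
  have e3 : 0 ≤ (-l) * ((v - w) ^ 2 / w) := mul_nonneg (by linarith) (by positivity)
  have e4 : (-l) * ((v - w) ^ 2 / w) = -l * v * (v / w) + 2 * l * v - l * w := by
    field_simp; ring
  linarith

lemma aux_min (y l v : ℝ) (hy : 0 < y) (hv : 0 < v) (hl : l ≤ 0)
    (hs : v - y = l * v ^ 2) (h : EReal)
    (hh : h = ⨅ w : Ici (0:ℝ), (dbeta 0 y w - ((l * w : ℝ) : EReal))) :
    h = ((y / v - Real.log (y / v) - 1 - l * v : ℝ) : EReal) ∧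
    (∀ w : ℝ, 0 ≤ w → dbeta 0 y w - ((l * w : ℝ) : EReal) = h → w = v) := by
  have key : h = ((y / v - Real.log (y / v) - 1 - l * v : ℝ) : EReal) := by
    rw [hh]
    apply le_antisymm
    · rw [← aux_val y l v hy hv]
      exact iInf_le (fun w : Ici (0:ℝ) => (dbeta 0 y w - ((l * w : ℝ) : EReal))) ⟨v, hv.le⟩
    · refine le_iInf ?_
      rintro ⟨w, hw⟩
      rcases (show (0:ℝ) ≤ w from hw).eq_or_lt with h0 | h0
      · subst h0
        rw [aux_zero]; exact le_top
      · simp only []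
        rw [aux_val y l w hy h0, EReal.coe_le_coe_iff]
        by_cases hne : w = v
        · rw [hne]
        · exact (aux_lt y l v w hy hv h0 hl hs hne).le
  refine ⟨key, fun w hw he => ?_⟩
  rw [key] at he
  rcases hw.eq_or_lt with h0 | h0
  · subst h0
    rw [aux_zero] at he
    exact absurd he.symm (EReal.coe_ne_top _)
  · rw [aux_val y l w hy h0, EReal.coe_eq_coe_iff] at he
    by_contra hne
    exact (aux_lt y l v w hy hv h0 hl hs hne).ne' he

/-- Computation of h(y,λ) = inf_{w ≥ 0} (d₀(y|w) − λw) for the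
Itakura–Saito divergence (β = 0), with y > 0. -/
theorem stmt18 (y : ℝ) (hy : 0 < y) (l : ℝ)
    (h : EReal)
    (hh : h = ⨅ w : Ici (0:ℝ), (dbeta 0 y w - ((l * w : ℝ) : EReal)))
    (w₀ : ℝ) (hw₀ : w₀ = (Real.sqrt (1 - 4 * l * y) - 1) / (-2 * l)) :
    (l < 0 →
      h = ((Real.sqrt (1 - 4 * l * y) -
        Real.log ((Real.sqrt (1 - 4 * l * y) + 1) / 2) - 1 : ℝ) : EReal) ∧
      dbeta 0 y w₀ - ((l * w₀ : ℝ) : EReal) = h ∧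
      (∀ w : ℝ, 0 ≤ w → dbeta 0 y w - ((l * w : ℝ) : EReal) = h → w = w₀) ∧
      0 < w₀ ∧ (w₀ ^ 2)⁻¹ * (w₀ - y) = l ∧
      (∀ w : ℝ, 0 < w → (w ^ 2)⁻¹ * (w - y) = l → w = w₀)) ∧
    (l = 0 →
      h = 0 ∧
      dbeta 0 y y - ((l * y : ℝ) : EReal) = h ∧
      (∀ w : ℝ, 0 ≤ w → dbeta 0 y w - ((l * w : ℝ) : EReal) = h → w = y)) ∧
    (0 < l → h = ⊥) := by
  refine ⟨fun hl => ?_, fun hl => ?_, fun hl => ?_⟩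
  · set s := Real.sqrt (1 - 4 * l * y) with hsdef
    have hly : 0 < -l * y := mul_pos (by linarith) hy
    have hs2 : s ^ 2 = 1 - 4 * l * y := Real.sq_sqrt (by linarith)
    have hs0 : 0 ≤ s := Real.sqrt_nonneg _
    have hs1 : 1 < s := by nlinarith
    have hl2 : (-2 * l) ≠ 0 := by
      intro hc; linarith
    have hw : 0 < w₀ := by
      rw [hw₀]; exact div_pos (by linarith) (by linarith)
    have hlw : l * w₀ = (1 - s) / 2 := by
      have hl0 : l ≠ 0 := hl.ne
      rw [hw₀]; field_simp; ring
    have hyw : y = w₀ * ((s + 1) / 2) := by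
      have : l * y = l * (w₀ * ((s + 1) / 2)) := by
        rw [← mul_assoc, hlw]; linarith
      exact mul_left_cancel₀ hl.ne this
    have hst : w₀ - y = l * w₀ ^ 2 := by
      have : l * w₀ ^ 2 = (l * w₀) * w₀ := by ring
      rw [this, hlw, hyw]; ring
    have hdiv : y / w₀ = (s + 1) / 2 := by
      rw [div_eq_iff hw.ne']; linarith
    obtain ⟨h1, h2⟩ := aux_min y l w₀ hy hw hl.le hst h hh
    refine ⟨?_, ?_, h2, hw, ?_, ?_⟩
    · rw [h1, hdiv, hlw, EReal.coe_eq_coe_iff]; ring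
    · rw [h1, aux_val y l w₀ hy hw]
    · rw [hst]; field_simp
    · intro w hw' he
      have hst' : w - y = l * w ^ 2 := by
        rw [← he]; field_simp
      by_contra hne
      exact lt_asymm (aux_lt y l w₀ w hy hw hw' hl.le hst hne)
        (aux_lt y l w w₀ hy hw' hw hl.le hst' (Ne.symm hne))
  · obtain ⟨h1, h2⟩ := aux_min y l y hy hy hl.le (by rw [hl]; ring) h hh
    refine ⟨?_, ?_, h2⟩
    · rw [h1, hl, div_self hy.ne']; simp
    · rw [h1, aux_val y l y hy hy]
  · rw [EReal.eq_bot_iff_forall_lt]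
    intro r
    set C := Real.log (2 / l) - Real.log y - 1 with hC
    set w := max y (2 * (C - r + 1) / l) with hwdef
    have hwy : y ≤ w := le_max_left _ _
    have hw : 0 < w := lt_of_lt_of_le hy hwy
    have hw2 : 2 * (C - r + 1) ≤ w * l := by
      rw [← div_le_iff₀ hl]; exact le_max_right _ _
    have hle : h ≤ ((y / w - Real.log (y / w) - 1 - l * w : ℝ) : EReal) := by
      rw [← aux_val y l w hy hw, hh]
      exact iInf_le (fun w : Ici (0:ℝ) => (dbeta 0 y w - ((l * w : ℝ) : EReal))) ⟨w, hw.le⟩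
    refine lt_of_le_of_lt hle ?_
    rw [EReal.coe_lt_coe_iff, Real.log_div hy.ne' hw.ne']
    have h3 : y / w ≤ 1 := (div_le_one hw).2 hwy
    have h4 := Real.log_le_sub_one_of_pos (show 0 < w / (2 / l) by positivity)
    rw [Real.log_div hw.ne' (by positivity)] at h4
    have h5 : w / (2 / l) = w * l / 2 := by field_simp
    rw [h5] at h4
    linarith
end
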